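/- arXiv:1604.08832 — 3 statements merged into one kernel-verified Lean document; each statement's English description precedes it below -/
import Mathlib

section
/- (Corollary 1: currents stall.) Let F, λ, g : ℝ^M × ℝ^M → ℝ be continuously differentiable functions with F(q, x) = λ(q, x)·g(q, x) for all (q, x), and let x* ∈ ℝ^M be such that: F(x* − x, x) = 0 for all x ∈ ℝ^M; F(0, x) = 0 for all x ∈ ℝ^M; λ(0, x*) = 0; and g(0, x*) ≠ 0. Then for every μ ∈ Fin M, ∂λ/∂q_μ (0, x*) = 0. -/
/-- Corollary 1: currents stall: if `F = λ·g` with `F(x*−x,x) = 0` and `F(0,x) = 0`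
for all `x`, `λ(0,x*) = 0` and `g(0,x*) ≠ 0`, then all partial derivatives of `λ` in the
counting-field block vanish at `(0, x*)`, i.e. all edge currents stall at `x*`. -/
theorem stmt5 {M : ℕ}
    (F lam g : (Fin M → ℝ) × (Fin M → ℝ) → ℝ)
    (hF : ContDiff ℝ 1 F) (hlam : ContDiff ℝ 1 lam) (hg : ContDiff ℝ 1 g)
    (hFactor : ∀ p, F p = lam p * g p)
    (xstar : Fin M → ℝ)
    (h1 : ∀ x : Fin M → ℝ, F (xstar - x, x) = 0)
    (h2 : ∀ x : Fin M → ℝ, F (0, x) = 0)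
    (hlam0 : lam ((0 : Fin M → ℝ), xstar) = 0)
    (hg0 : g ((0 : Fin M → ℝ), xstar) ≠ 0) :
    ∀ μ : Fin M,
      fderiv ℝ lam ((0 : Fin M → ℝ), xstar) ((Pi.single μ 1 : Fin M → ℝ), (0 : Fin M → ℝ)) = 0 := by
  intro μ
  set p : (Fin M → ℝ) × (Fin M → ℝ) := (0, xstar) with hp
  have hFd : DifferentiableAt ℝ F p := hF.differentiable one_ne_zero p
  have hld : DifferentiableAt ℝ lam p := hlam.differentiable one_ne_zero p
  have hgd : DifferentiableAt ℝ g p := hg.differentiable one_ne_zero p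
  -- a line through `p` on which `F` vanishes gives a null direction of the derivative
  have key : ∀ w, (∀ t : ℝ, F (p + t • w) = 0) → fderiv ℝ F p w = 0 := by
    intro w hw
    rw [← hFd.lineDeriv_eq_fderiv, lineDeriv]
    simp [hw]
  set v : Fin M → ℝ := Pi.single μ 1 with hv
  have e1 : fderiv ℝ F p (v, -v) = 0 := by
    apply key
    intro t
    have := h1 (xstar - t • v)
    rw [← this]
    congr 1
    ext i <;> simp [hp, sub_eq_add_neg]
  have e2 : fderiv ℝ F p (0, v) = 0 := by
    apply key
    intro t
    rw [← h2 (xstar + t • v)]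
    congr 1
    ext i <;> simp [hp]
  have e3 : fderiv ℝ F p (v, 0) = 0 := by
    have : ((v, 0) : (Fin M → ℝ) × (Fin M → ℝ)) = (v, -v) + (0, v) := by simp
    rw [this, map_add, e1, e2, add_zero]
  have hFe : F = fun p => lam p * g p := funext hFactor
  rw [hFe, fderiv_fun_mul hld hgd] at e3
  simpa [hlam0, hg0] using e3
end

section
/- (Corollary 2: mixed fluctuation–response relation at stalling.) Let F, λ, g : ℝ^M × ℝ^M → ℝ be twice continuously differentiable functions with F(q, x) = λ(q, x)·g(q, x) for all (q, x), and let x* ∈ ℝ^M be such that: F(x* − x, x) = 0 for all x ∈ ℝ^M; λ(0, x) = 0 for all x ∈ ℝ^M; and g(0, x*) ≠ 0. Then for all μ, ν ∈ Fin M, at the point (0, x*): ∂²λ/∂q_μ∂q_ν = ∂²λ/∂x_ν∂q_μ + ∂²λ/∂x_μ∂q_ν. -/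
open Filter Topology in
theorem aux_second {E G : Type*} [NormedAddCommGroup E] [NormedSpace ℝ E]
    [NormedAddCommGroup G] [NormedSpace ℝ G] (f : G → ℝ) (hf : ContDiff ℝ 2 f)
    (A : E → G) (L : E →L[ℝ] G) (hA : ∀ x, HasFDerivAt A L x) (x0 : E)
    (h0 : ∀ᶠ x in 𝓝 x0, f (A x) = 0) (u v : E) :
    fderiv ℝ (fderiv ℝ f) (A x0) (L u) (L v) = 0 := by
  have hd : Differentiable ℝ f := hf.differentiable (by norm_num)
  have hd2 : Differentiable ℝ (fderiv ℝ f) :=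
    (hf.fderiv_right (m := 1) (by norm_num)).differentiable (by norm_num)
  have e1 : ∀ᶠ x in 𝓝 x0, fderiv ℝ f (A x) (L v) = 0 := by
    filter_upwards [h0.eventually_nhds] with x hx
    have k1 : HasFDerivAt (fun y => f (A y)) ((fderiv ℝ f (A x)).comp L) x :=
      (hd (A x)).hasFDerivAt.comp x (hA x)
    have k2 : HasFDerivAt (fun y => f (A y)) (0 : E →L[ℝ] ℝ) x :=
      (hasFDerivAt_const (0 : ℝ) x).congr_of_eventuallyEq hx
    have := congrArg (fun T : E →L[ℝ] ℝ => T v) (k1.unique k2)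
    simpa using this
  have k1 : HasFDerivAt (fun y => fderiv ℝ f (A y)) ((fderiv ℝ (fderiv ℝ f) (A x0)).comp L) x0 :=
    (hd2 (A x0)).hasFDerivAt.comp x0 (hA x0)
  have k1' := k1.clm_apply (hasFDerivAt_const (L v) x0)
  have k2 : HasFDerivAt (fun y => fderiv ℝ f (A y) (L v)) (0 : E →L[ℝ] ℝ) x0 :=
    (hasFDerivAt_const (0 : ℝ) x0).congr_of_eventuallyEq e1
  have := congrArg (fun T : E →L[ℝ] ℝ => T u) (k1'.unique k2)
  simpa using this

/-- Corollary 2: mixed fluctuation–response relation at stalling: if `F = λ·g`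
with `F(x*−x,x) = 0` for all `x`, `λ(0,x) = 0` for all `x`, and `g(0,x*) ≠ 0`, then at `(0,x*)`
`∂²λ/∂q_μ∂q_ν = ∂²λ/∂x_ν∂q_μ + ∂²λ/∂x_μ∂q_ν`. -/
theorem stmt6 {M : ℕ}
    (F lam g : (Fin M → ℝ) × (Fin M → ℝ) → ℝ)
    (hF : ContDiff ℝ 2 F) (hlam : ContDiff ℝ 2 lam) (hg : ContDiff ℝ 2 g)
    (hFactor : ∀ p, F p = lam p * g p)
    (xstar : Fin M → ℝ)
    (h1 : ∀ x : Fin M → ℝ, F (xstar - x, x) = 0)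
    (hlam0 : ∀ x : Fin M → ℝ, lam ((0 : Fin M → ℝ), x) = 0)
    (hg0 : g ((0 : Fin M → ℝ), xstar) ≠ 0) :
    ∀ μ ν : Fin M,
      fderiv ℝ (fun p => fderiv ℝ lam p ((Pi.single ν 1 : Fin M → ℝ), (0 : Fin M → ℝ)))
          ((0 : Fin M → ℝ), xstar) ((Pi.single μ 1 : Fin M → ℝ), (0 : Fin M → ℝ))
      = fderiv ℝ (fun p => fderiv ℝ lam p ((Pi.single μ 1 : Fin M → ℝ), (0 : Fin M → ℝ)))
          ((0 : Fin M → ℝ), xstar) ((0 : Fin M → ℝ), (Pi.single ν 1 : Fin M → ℝ))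
      + fderiv ℝ (fun p => fderiv ℝ lam p ((Pi.single ν 1 : Fin M → ℝ), (0 : Fin M → ℝ)))
          ((0 : Fin M → ℝ), xstar) ((0 : Fin M → ℝ), (Pi.single μ 1 : Fin M → ℝ)) := by
  intro μ ν
  have hd2 : Differentiable ℝ (fderiv ℝ lam) :=
    (hlam.fderiv_right (m := 1) (by norm_num)).differentiable (by norm_num)
  have key : ∀ (p v w : (Fin M → ℝ) × (Fin M → ℝ)),
      fderiv ℝ (fun p => fderiv ℝ lam p v) p w = fderiv ℝ (fderiv ℝ lam) p w v := by
    intro p v w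
    have := (hd2 p).hasFDerivAt.clm_apply (hasFDerivAt_const v p)
    rw [this.fderiv]
    simp
  rw [key, key, key]
  have hsymm : ∀ v w, fderiv ℝ (fderiv ℝ lam) ((0 : Fin M → ℝ), xstar) v w
      = fderiv ℝ (fderiv ℝ lam) ((0 : Fin M → ℝ), xstar) w v := by
    have : IsSymmSndFDerivAt ℝ lam ((0 : Fin M → ℝ), xstar) :=
      hlam.contDiffAt.isSymmSndFDerivAt (by simp)
    intro v w
    exact this v w
  have a1 := aux_second lam hlam (fun x : Fin M → ℝ => ((0 : Fin M → ℝ), x))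
    (ContinuousLinearMap.prod 0 (ContinuousLinearMap.id ℝ _))
    (fun x => (hasFDerivAt_const _ x).prodMk (hasFDerivAt_id x)) xstar
    (Filter.Eventually.of_forall hlam0)
    (Pi.single μ 1) (Pi.single ν 1)
  have hcont : Continuous (fun x : Fin M → ℝ => g (xstar - x, x)) :=
    hg.continuous.comp (by fun_prop)
  have hne : ∀ᶠ x in nhds xstar, g (xstar - x, x) ≠ 0 :=
    hcont.continuousAt.eventually_ne (by simpa using hg0)
  have a2 := aux_second lam hlam (fun x : Fin M → ℝ => (xstar - x, x))
    (ContinuousLinearMap.prod (-ContinuousLinearMap.id ℝ _) (ContinuousLinearMap.id ℝ _))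
    (fun x => ((hasFDerivAt_id x).const_sub xstar).prodMk (hasFDerivAt_id x)) xstar
    (by
      filter_upwards [hne] with x hx
      have := h1 x
      rw [hFactor] at this
      exact (mul_eq_zero.mp this).resolve_right hx)
    (Pi.single μ 1) (Pi.single ν 1)
  simp only [ContinuousLinearMap.prod_apply, ContinuousLinearMap.zero_apply,
    ContinuousLinearMap.neg_apply, ContinuousLinearMap.id_apply, sub_self] at a1 a2
  have dec : ∀ w : Fin M → ℝ, ((-w, w) : (Fin M → ℝ) × (Fin M → ℝ)) = (0, w) - (w, 0) := by
    intro w; simp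
  rw [dec, dec] at a2
  simp only [map_sub, ContinuousLinearMap.sub_apply] at a2
  have s := hsymm ((0 : Fin M → ℝ), Pi.single ν 1) (Pi.single μ 1, (0 : Fin M → ℝ))
  linarith
end

section
/- (Combined main theorem in terms of the cumulant generating function.) Let λ, g, F : ℝ^M × ℝ^M → ℝ be twice continuously differentiable with F = λ·g pointwise, and let x* ∈ ℝ^M satisfy: F(x* − x, x) = 0 for all x ∈ ℝ^M; λ(0, x) = 0 for all x ∈ ℝ^M; and g(0, x*) ≠ 0. Define the edge currents J_μ(x) := ∂λ/∂q_μ (0, x) and the edge diffusivities D_{μν} := (1/2)·∂²λ/∂q_μ∂q_ν (0, x*). Let d : Fin M → ℝ, h* ∈ ℝ, and set x(h)_μ = x*_μ + d_μ (h − h*) and J_α(h) := Σ_μ d_μ · J_μ(x(h)). Then (d/dh) J_α (h*) = Σ_{μ,ν} d_μ d_ν D_{μν}. -/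
/-- derivative along a line of the first derivative -/
lemma aux_line {E : Type*} [NormedAddCommGroup E] [NormedSpace ℝ E] (f : E → ℝ)
    (hf : ContDiff ℝ 2 f) (p v u : E) :
    HasDerivAt (fun t : ℝ => fderiv ℝ f (p + t • v) u) (fderiv ℝ (fderiv ℝ f) p v u) 0 := by
  have hd : Differentiable ℝ (fderiv ℝ f) :=
    (hf.fderiv_right (m := 1) (by norm_num)).differentiable (by norm_num)
  have hl : HasDerivAt (fun t : ℝ => p + t • v) v 0 := by
    simpa using ((hasDerivAt_id (0 : ℝ)).smul_const v).const_add p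
  have h0 : HasFDerivAt (fderiv ℝ f) (fderiv ℝ (fderiv ℝ f) p) (p + (0 : ℝ) • v) := by
    simpa using (hd p).hasFDerivAt
  have h2 := h0.comp_hasDerivAt (0 : ℝ) hl
  have h3 := h2.clm_apply (hasDerivAt_const (0 : ℝ) u)
  simpa using h3

lemma aux_zero {E : Type*} [NormedAddCommGroup E] [NormedSpace ℝ E] (f : E → ℝ)
    (hf : ContDiff ℝ 2 f) (p v : E) (h : ∀ᶠ t : ℝ in nhds 0, f (p + t • v) = 0) :
    fderiv ℝ (fderiv ℝ f) p v v = 0 := by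
  have hd : Differentiable ℝ f := hf.differentiable (by norm_num)
  have h1 : ∀ t : ℝ, HasDerivAt (fun t : ℝ => f (p + t • v)) (fderiv ℝ f (p + t • v) v) t := by
    intro t
    have hl : HasDerivAt (fun t : ℝ => p + t • v) v t := by
      simpa using ((hasDerivAt_id t).smul_const v).const_add p
    exact (hd (p + t • v)).hasFDerivAt.comp_hasDerivAt t hl
  have h2 : ∀ᶠ t : ℝ in nhds 0, fderiv ℝ f (p + t • v) v = 0 := by
    filter_upwards [h.eventually_nhds] with t ht
    have h3 : HasDerivAt (fun t : ℝ => f (p + t • v)) 0 t :=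
      (hasDerivAt_const t (0 : ℝ)).congr_of_eventuallyEq ht
    exact (h1 t).unique h3
  exact (aux_line f hf p v v).unique
    ((hasDerivAt_const (0 : ℝ) (0 : ℝ)).congr_of_eventuallyEq h2)

/-- Combined main theorem in terms of the cumulant generating function:
from the determinant relation `F(x*−x,x) = 0` with `F = λ·g`, `λ(0,x) = 0` for all `x` and
`g(0,x*) ≠ 0`, the physical current built from the edge currents `J_μ(x) = ∂λ/∂q_μ(0,x)`
satisfies the FDR `(d/dh) J_α(h*) = Σ_{μ,ν} d_μ d_ν D_{μν}` with the edge diffusivities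
`D_{μν} = (1/2) ∂²λ/∂q_μ∂q_ν (0,x*)`. -/
theorem stmt9 {M : ℕ}
    (F lam g : (Fin M → ℝ) × (Fin M → ℝ) → ℝ)
    (hF : ContDiff ℝ 2 F) (hlam : ContDiff ℝ 2 lam) (hg : ContDiff ℝ 2 g)
    (hFactor : ∀ p, F p = lam p * g p)
    (xstar : Fin M → ℝ)
    (h1 : ∀ x : Fin M → ℝ, F (xstar - x, x) = 0)
    (hlam0 : ∀ x : Fin M → ℝ, lam ((0 : Fin M → ℝ), x) = 0)
    (hg0 : g ((0 : Fin M → ℝ), xstar) ≠ 0)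
    (J : Fin M → (Fin M → ℝ) → ℝ)
    (hJ : ∀ μ x, J μ x =
      fderiv ℝ lam ((0 : Fin M → ℝ), x) ((Pi.single μ 1 : Fin M → ℝ), (0 : Fin M → ℝ)))
    (D : Fin M → Fin M → ℝ)
    (hD : ∀ μ ν, D μ ν = (1 / 2) *
      fderiv ℝ (fun p => fderiv ℝ lam p ((Pi.single ν 1 : Fin M → ℝ), (0 : Fin M → ℝ)))
        ((0 : Fin M → ℝ), xstar) ((Pi.single μ 1 : Fin M → ℝ), (0 : Fin M → ℝ)))
    (d : Fin M → ℝ) (hstar : ℝ)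
    (x : ℝ → Fin M → ℝ) (hx : ∀ h μ, x h μ = xstar μ + d μ * (h - hstar))
    (Jalpha : ℝ → ℝ) (hJa : ∀ h, Jalpha h = ∑ μ : Fin M, d μ * J μ (x h)) :
    deriv Jalpha hstar = ∑ μ : Fin M, ∑ ν : Fin M, d μ * d ν * D μ ν := by
  have hd : Differentiable ℝ (fderiv ℝ lam) :=
    (hlam.fderiv_right (m := 1) (by norm_num)).differentiable (by norm_num)
  set p : (Fin M → ℝ) × (Fin M → ℝ) := ((0 : Fin M → ℝ), xstar) with hp
  set e : Fin M → (Fin M → ℝ) × (Fin M → ℝ) :=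
    fun μ => ((Pi.single μ 1 : Fin M → ℝ), (0 : Fin M → ℝ)) with he
  set u : (Fin M → ℝ) × (Fin M → ℝ) := (d, 0) with hu
  set w : (Fin M → ℝ) × (Fin M → ℝ) := (0, d) with hw
  have hue : u = ∑ μ, d μ • e μ := by
    ext i
    · simp [hu, he, Prod.fst_sum, Finset.sum_apply, Pi.single_apply]
    · simp [hu, he, Prod.snd_sum]
  set B := fderiv ℝ (fderiv ℝ lam) p with hB
  have hsymm : B u w = B w u := by
    have : IsSymmSndFDerivAt ℝ lam p := hlam.contDiffAt.isSymmSndFDerivAt (by simp)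
    exact this u w
  have hww : B w w = 0 := by
    apply aux_zero lam hlam p w
    refine Filter.Eventually.of_forall fun t => ?_
    have : p + t • w = (0, xstar + t • d) := by simp [hp, hw]
    rw [this]; exact hlam0 _
  have hvv : B (w - u) (w - u) = 0 := by
    apply aux_zero lam hlam p (w - u)
    have hc : Continuous fun t : ℝ => g (p + t • (w - u)) :=
      hg.continuous.comp (by fun_prop)
    have hne := hc.continuousAt.eventually_ne (x := (0 : ℝ)) (y := 0) (by simpa using hg0)
    filter_upwards [hne] with t ht
    have h2 := h1 (xstar + t • d)
    have h3 : p + t • (w - u) = (xstar - (xstar + t • d), xstar + t • d) := by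
      simp [hp, hw, hu]
    rw [← h3, hFactor] at h2
    exact (mul_eq_zero.mp h2).resolve_right ht
  have hJd : HasDerivAt Jalpha (B w u) hstar := by
    have h4 := aux_line lam hlam p w u
    have h5 : HasDerivAt (fun h : ℝ => h - hstar) 1 hstar :=
      (hasDerivAt_id hstar).sub_const hstar
    have h4' : HasDerivAt (fun t : ℝ => fderiv ℝ lam (p + t • w) u) (B w u)
      (hstar - hstar) := by simpa using h4
    have h6 := HasDerivAt.comp (h := fun h : ℝ => h - hstar) hstar h4' h5
    rw [mul_one] at h6
    refine h6.congr_of_eventuallyEq (Filter.Eventually.of_forall fun h => ?_)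
    have h7 : p + (h - hstar) • w = ((0 : Fin M → ℝ), x h) := by
      ext i
      · simp [hp, hw]
      · simp [hp, hw, hx, mul_comm]
    simp only [Function.comp, h7, hJa, hJ]
    rw [hue, map_sum]
    simp only [map_smul, smul_eq_mul, he]
  have hDB : ∀ μ ν, D μ ν = (1 / 2) * B (e μ) (e ν) := by
    intro μ ν
    rw [hD]
    have h8 : HasFDerivAt (fun p => fderiv ℝ lam p (e ν)) (B.flip (e ν)) p := by
      have := (hd p).hasFDerivAt.clm_apply (hasFDerivAt_const (e ν) p)
      simpa using this
    have h9 := h8.fderiv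
    simp only [he] at h9 ⊢
    rw [h9]; rfl
  have hBuu : B u u = ∑ μ, ∑ ν, d μ * d ν * B (e μ) (e ν) := by
    rw [hue]
    simp only [map_sum, map_smul, ContinuousLinearMap.sum_apply, ContinuousLinearMap.smul_apply,
      smul_eq_mul, Finset.mul_sum]
    rw [Finset.sum_comm]
    refine Finset.sum_congr rfl fun μ _ => Finset.sum_congr rfl fun ν _ => ?_
    ring
  rw [hJd.deriv]
  have hR : ∑ μ, ∑ ν, d μ * d ν * D μ ν = (1 / 2) * B u u := by
    rw [hBuu]
    simp only [Finset.mul_sum, hDB]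
    refine Finset.sum_congr rfl fun μ _ => Finset.sum_congr rfl fun ν _ => ?_
    ring
  rw [hR]
  simp only [map_sub, ContinuousLinearMap.sub_apply] at hvv
  linarith
end
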